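/- arXiv:2510.04151 — 2 statements merged into one kernel-verified Lean document; each statement's English description precedes it below -/
import Mathlib

section
/- The intersection form of the generalized Frobenius manifold M has the explicit matrix: for all (z¹,z²,z³) with z¹ > 0 and all α,β ∈ {1,2,3}, Σ_γ E^γ Σ_{μ,ν} η^{αμ} η^{βν} ∂³F/∂z^γ∂z^μ∂z^ν equals the (α,β) entry of the matrix [[4z¹e^{2z³} + 2√2 z¹z² e^{z³}, (3/√2) z¹ e^{z³}, z¹ + √2 z² e^{z³} + e^{2z³}], [(3/√2) z¹ e^{z³}, z¹ − ½(z²)², e^{z³}/√2 + ½z²], [z¹ + √2 z² e^{z³} + e^{2z³}, e^{z³}/√2 + ½z², 3/2]], where (E¹,E²,E³) = (z¹, ½z², ½). -/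
/-- Partial derivative in the first slot. -/
noncomputable def pd1 (f : ℝ → ℝ → ℝ → ℝ) : ℝ → ℝ → ℝ → ℝ :=
  fun x y z => deriv (fun t => f t y z) x

/-- Partial derivative in the second slot. -/
noncomputable def pd2 (f : ℝ → ℝ → ℝ → ℝ) : ℝ → ℝ → ℝ → ℝ :=
  fun x y z => deriv (fun t => f x t z) y

/-- Partial derivative in the third slot. -/
noncomputable def pd3 (f : ℝ → ℝ → ℝ → ℝ) : ℝ → ℝ → ℝ → ℝ :=
  fun x y z => deriv (fun t => f x y t) z

/-- Partial derivative in the (i+1)-st variable. -/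
noncomputable def pd (i : Fin 3) : (ℝ → ℝ → ℝ → ℝ) → (ℝ → ℝ → ℝ → ℝ) :=
  ![pd1, pd2, pd3] i

/-- The potential of the generalized Frobenius manifold of the (2,1)-type RR2T. -/
noncomputable def Fpot (x y z : ℝ) : ℝ :=
  (1/2) * x^2 * z + (1/2) * x * y^2 + Real.sqrt 2 * x * y * Real.exp z
    + (1/2) * x * Real.exp (2*z) - (1/24) * y^4 + (1/2) * x^2 * Real.log x

/-- The flat metric η, with η_{αβ} = 1 iff α + β = 4 (indices shifted to 0,1,2). -/
noncomputable def eta (a b : Fin 3) : ℝ := if (a : ℕ) + (b : ℕ) = 2 then 1 else 0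

/-- Third partial derivatives c_{αβγ} = ∂³F/∂z^α∂z^β∂z^γ of the potential. -/
noncomputable def cF (a b g : Fin 3) : ℝ → ℝ → ℝ → ℝ := pd a (pd b (pd g Fpot))

/-- The explicit matrix of the intersection form of M. -/
noncomputable def Gmat (x y z : ℝ) : Matrix (Fin 3) (Fin 3) ℝ :=
  !![4*x*Real.exp (2*z) + 2*Real.sqrt 2*x*y*Real.exp z,
       3/Real.sqrt 2 * x * Real.exp z,
       x + Real.sqrt 2*y*Real.exp z + Real.exp (2*z);
     3/Real.sqrt 2 * x * Real.exp z,
       x - (1/2)*y^2,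
       Real.exp z/Real.sqrt 2 + (1/2)*y;
     x + Real.sqrt 2*y*Real.exp z + Real.exp (2*z),
       Real.exp z/Real.sqrt 2 + (1/2)*y,
       3/2]

/-- The gradient of the potential on the half-space `0 < x`. -/
noncomputable def gradF (i : Fin 3) : ℝ → ℝ → ℝ → ℝ :=
  ![fun x y z => x * z + (1/2) * y^2 + √2 * y * Real.exp z + (1/2) * Real.exp (2*z)
      + x * Real.log x + (1/2) * x,
    fun x y z => x * y + √2 * x * Real.exp z - (1/6) * y^3,
    fun x y z => (1/2) * x^2 + √2 * x * y * Real.exp z + x * Real.exp (2*z)] i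

/-- The Hessian of the potential on the half-space `0 < x`. -/
noncomputable def hessF (i j : Fin 3) : ℝ → ℝ → ℝ → ℝ :=
  ![![fun x _ z => z + Real.log x + 3/2,
      fun _ y z => y + √2 * Real.exp z,
      fun x y z => x + √2 * y * Real.exp z + Real.exp (2*z)],
    ![fun _ y z => y + √2 * Real.exp z,
      fun x y _ => x - (1/2) * y^2,
      fun x _ z => √2 * x * Real.exp z],
    ![fun x y z => x + √2 * y * Real.exp z + Real.exp (2*z),
      fun x _ z => √2 * x * Real.exp z,
      fun x y z => √2 * x * y * Real.exp z + 2 * x * Real.exp (2*z)]] i j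

theorem pd_congr_of_pos {f g : ℝ → ℝ → ℝ → ℝ} (h : ∀ x y z, 0 < x → f x y z = g x y z)
    (i : Fin 3) {x : ℝ} (y z : ℝ) (hx : 0 < x) : pd i f x y z = pd i g x y z := by
  fin_cases i
  · refine Filter.EventuallyEq.deriv_eq ?_
    filter_upwards [lt_mem_nhds hx] with t ht using h t y z ht
  · exact congrArg (deriv · y) (funext fun t => h x t z hx)
  · exact congrArg (deriv · z) (funext fun t => h x y t hx)

theorem pd_Fpot (i : Fin 3) (x y z : ℝ) (hx : 0 < x) : pd i Fpot x y z = gradF i x y z := by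
  have hx' := hx.ne'
  fin_cases i <;>
    simp only [pd, pd1, pd2, pd3, Fpot, gradF, Fin.zero_eta, Fin.mk_one,
      Fin.reduceFinMk, Matrix.cons_val] <;>
    simp (disch := first | fun_prop (disch := assumption) | assumption)
      [deriv_fun_add, deriv_fun_sub, deriv_fun_mul] <;>
    field_simp <;> ring

theorem pd_gradF (i j : Fin 3) (x y z : ℝ) (hx : 0 < x) :
    pd i (gradF j) x y z = hessF i j x y z := by
  have hx' := hx.ne'
  fin_cases i <;> fin_cases j <;>
    simp only [pd, pd1, pd2, pd3, hessF, gradF, Fin.zero_eta, Fin.mk_one,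
      Fin.reduceFinMk, Matrix.cons_val] <;>
    simp (disch := first | fun_prop (disch := assumption) | assumption)
      [deriv_fun_add, deriv_fun_sub, deriv_fun_mul] <;>
    try (field_simp <;> ring)

theorem cF_eq_pd_hessF (i j k : Fin 3) (x y z : ℝ) (hx : 0 < x) :
    cF i j k x y z = pd i (hessF j k) x y z :=
  pd_congr_of_pos (fun x y z hx => (pd_congr_of_pos (pd_Fpot k) j y z hx).trans
    (pd_gradF j k x y z hx)) i y z hx

/-- the intersection form g^{αβ} = Σ_γ E^γ η^{αμ} η^{βν} ∂³F/∂z^γ∂z^μ∂z^ν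
has the stated explicit matrix, with Euler field E = (z¹, ½z², ½). -/
theorem intersection_form_explicit (x y z : ℝ) (hx : 0 < x) (α β : Fin 3) :
    ∑ γ : Fin 3, ![x, (1/2)*y, (1/2 : ℝ)] γ *
      (∑ μ : Fin 3, ∑ ν : Fin 3, eta α μ * eta β ν * cF γ μ ν x y z)
    = Gmat x y z α β := by
  have hx' := hx.ne'
  have div_sqrt_two (a : ℝ) : a / √2 = a * √2 / 2 := by
    field_simp
    norm_num
  simp only [cF_eq_pd_hessF _ _ _ x y z hx]
  fin_cases α <;> fin_cases β <;>
    simp only [Fin.sum_univ_three, eta, Gmat, div_sqrt_two, pd, pd1, pd2, pd3, hessF,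
      Fin.zero_eta, Fin.mk_one, Fin.reduceFinMk, Matrix.cons_val] <;>
    simp (disch := first | fun_prop (disch := assumption) | assumption)
      [deriv_fun_add, deriv_fun_sub, deriv_fun_mul] <;>
    field_simp <;> ring
end

section
/- Fix (u,v,w) with w > 0, v > 0 and v + uw + w² > 0, let Φ(u,v,w) = (v + uw + w², (u+w)/√2, log w), J = [[w, 1, u+2w], [1/√2, 0, 1/√2], [0, 0, 1/w]], J⁻¹ = [[0, √2, −w], [1, −√2 w, −(u+w)w], [0, 0, w]], and let A be the 3×3 matrix with entries A^μ_ρ = Σ_ν η^{μν} (∂²θ_{1,1}/∂z^ν∂z^ρ)(Φ(u,v,w)), where θ_{1,1} = z¹(z³ + log z¹ − 1) + ½(z²)² + √2 z² e^{z³} + ½ e^{2z³}. Then J⁻¹ A J = (1/(v + uw + w²)) [[v + uw, −w, uw + 2v], [vw, v, uv + 2vw], [w², w, v + 2uw + 3w²]]; i.e. the ∂/∂t^{1,0} flow of the Principal Hierarchy of M, written in the coordinates (u,v,w), is (u,v,w)_{t^{1,0}} equal to this matrix applied to (u_x, v_x, w_x). -/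
open Matrix

/-- The matrix A_θ with entries (A_θ)^μ_ρ = Σ_ν η^{μν} ∂²θ/∂z^ν∂z^ρ, evaluated at (x,y,z). -/
noncomputable def Amat (θ : ℝ → ℝ → ℝ → ℝ) (x y z : ℝ) : Matrix (Fin 3) (Fin 3) ℝ :=
  Matrix.of fun μ ρ => ∑ ν : Fin 3, eta μ ν * pd ν (pd ρ θ) x y z

/-- The Jacobian J of the coordinate change Φ(u,v,w) = (v+uw+w², (u+w)/√2, log w). -/
noncomputable def Jmat (u v w : ℝ) : Matrix (Fin 3) (Fin 3) ℝ :=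
  !![w, 1, u + 2*w;
     1/Real.sqrt 2, 0, 1/Real.sqrt 2;
     0, 0, 1/w]

/-- The inverse Jacobian J⁻¹. -/
noncomputable def Jinv (u v w : ℝ) : Matrix (Fin 3) (Fin 3) ℝ :=
  !![0, Real.sqrt 2, -w;
     1, -Real.sqrt 2 * w, -(u+w)*w;
     0, 0, w]

/-- θ_{1,1}. -/
noncomputable def θ11 (x y z : ℝ) : ℝ :=
  x * (z + Real.log x - 1) + (1/2)*y^2 + Real.sqrt 2 * y * Real.exp z + (1/2) * Real.exp (2*z)

theorem pd1_θ11 {x : ℝ} (hx : x ≠ 0) (y z : ℝ) : pd1 θ11 x y z = z + Real.log x := by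
  have h : HasDerivAt (fun t => θ11 t y z) (1 * (z + Real.log x - 1) + x * x⁻¹) x := by
    unfold θ11
    exact ((((hasDerivAt_id' x).mul
      (((Real.hasDerivAt_log hx).const_add z).sub_const 1)).add_const _).add_const _).add_const _
  rw [pd1, h.deriv, mul_inv_cancel₀ hx]
  ring

theorem pd2_θ11 (x y z : ℝ) : pd2 θ11 x y z = y + Real.sqrt 2 * Real.exp z := by
  have h : HasDerivAt (fun t => θ11 x t z)
      ((1/2) * (2 * y) + Real.sqrt 2 * 1 * Real.exp z) y := by
    unfold θ11
    have hsq : HasDerivAt (fun t : ℝ => t ^ 2) (2 * y) y := by simpa using hasDerivAt_pow 2 y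
    exact (((hsq.const_mul (1/2)).const_add _).add
      (((hasDerivAt_id' y).const_mul (Real.sqrt 2)).mul_const _)).add_const _
  rw [pd2, h.deriv]
  ring

theorem hasDerivAt_exp_two_mul (z : ℝ) :
    HasDerivAt (fun t : ℝ => Real.exp (2 * t)) (2 * Real.exp (2 * z)) z := by
  simpa [mul_comm] using ((hasDerivAt_id' z).const_mul 2).exp

theorem pd3_θ11 (x y z : ℝ) :
    pd3 θ11 x y z = x + Real.sqrt 2 * y * Real.exp z + Real.exp (2 * z) := by
  have h : HasDerivAt (fun t => θ11 x y t)
      (x * 1 + Real.sqrt 2 * y * Real.exp z + (1/2) * (2 * Real.exp (2 * z))) z := by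
    unfold θ11
    exact ((((((hasDerivAt_id' z).add_const _).sub_const 1).const_mul x).add_const _).add
      ((Real.hasDerivAt_exp z).const_mul _)).add ((hasDerivAt_exp_two_mul z).const_mul _)
  rw [pd3, h.deriv]
  ring

theorem pd1_pd1_θ11 {x : ℝ} (hx : x ≠ 0) (y z : ℝ) : pd1 (pd1 θ11) x y z = x⁻¹ := by
  have h : (fun t => pd1 θ11 t y z) =ᶠ[nhds x] fun t => z + Real.log t := by
    filter_upwards [isOpen_ne.mem_nhds hx] with t ht using pd1_θ11 ht y z
  rw [pd1, h.deriv_eq]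
  exact ((Real.hasDerivAt_log hx).const_add z).deriv

theorem pd2_pd1_θ11 {x : ℝ} (hx : x ≠ 0) (y z : ℝ) : pd2 (pd1 θ11) x y z = 0 := by
  simp [pd2, pd1_θ11 hx]

theorem pd3_pd1_θ11 {x : ℝ} (hx : x ≠ 0) (y z : ℝ) : pd3 (pd1 θ11) x y z = 1 := by
  simp [pd3, pd1_θ11 hx]

theorem pd1_pd2_θ11 (x y z : ℝ) : pd1 (pd2 θ11) x y z = 0 := by
  simp [pd1, pd2_θ11]

theorem pd2_pd2_θ11 (x y z : ℝ) : pd2 (pd2 θ11) x y z = 1 := by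
  rw [pd2]
  simp [pd2_θ11]

theorem pd3_pd2_θ11 (x y z : ℝ) : pd3 (pd2 θ11) x y z = Real.sqrt 2 * Real.exp z := by
  simp [pd3, pd2_θ11]

theorem pd1_pd3_θ11 (x y z : ℝ) : pd1 (pd3 θ11) x y z = 1 := by
  simp [pd1, pd3_θ11]

theorem pd2_pd3_θ11 (x y z : ℝ) : pd2 (pd3 θ11) x y z = Real.sqrt 2 * Real.exp z := by
  simp [pd2, pd3_θ11]

theorem pd3_pd3_θ11 (x y z : ℝ) :
    pd3 (pd3 θ11) x y z = Real.sqrt 2 * y * Real.exp z + 2 * Real.exp (2 * z) := by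
  rw [pd3]
  simp only [pd3_θ11]
  exact ((((Real.hasDerivAt_exp z).const_mul (Real.sqrt 2 * y)).const_add x).add
    (hasDerivAt_exp_two_mul z)).deriv

theorem Amat_θ11 {x : ℝ} (hx : x ≠ 0) (y z : ℝ) :
    Amat θ11 x y z =
      !![1, Real.sqrt 2 * Real.exp z, Real.sqrt 2 * y * Real.exp z + 2 * Real.exp (2 * z);
         0, 1, Real.sqrt 2 * Real.exp z;
         x⁻¹, 0, 1] := by
  ext i j
  fin_cases i <;> fin_cases j <;>
    simp [Amat, eta, pd, Fin.sum_univ_three, pd1_pd1_θ11 hx, pd2_pd1_θ11 hx, pd3_pd1_θ11 hx,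
      pd1_pd2_θ11, pd2_pd2_θ11, pd3_pd2_θ11, pd1_pd3_θ11, pd2_pd3_θ11, pd3_pd3_θ11]

/-- the ∂/∂t^{1,0} flow of the Principal Hierarchy of M, written in the
coordinates (u,v,w), is given by the stated matrix. -/
theorem t10_flow_in_uvw (u v w : ℝ) (hw : 0 < w) (hv : 0 < v)
    (hd : 0 < v + u*w + w^2) :
    Jinv u v w * Amat θ11 (v + u*w + w^2) ((u+w)/Real.sqrt 2) (Real.log w) * Jmat u v w
      = (1/(v + u*w + w^2)) •
        !![v + u*w, -w, u*w + 2*v;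
           v*w, v, u*v + 2*v*w;
           w^2, w, v + 2*u*w + 3*w^2] := by
  have hs : Real.sqrt 2 ^ 2 = 2 := Real.sq_sqrt (by norm_num)
  have hs0 : Real.sqrt 2 ≠ 0 := by positivity
  have hw0 := hw.ne'
  obtain ⟨d, rfl⟩ : ∃ d, v = d - u*w - w^2 := ⟨v + u*w + w^2, by ring⟩
  have hsum : d - u*w - w^2 + u*w + w^2 = d := by ring
  rw [hsum] at hd ⊢
  have hd0 := hd.ne'
  have he : Real.exp (2 * Real.log w) = w ^ 2 := by
    rw [two_mul, Real.exp_add, Real.exp_log hw, sq]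
  rw [Amat_θ11 hd0, he, Real.exp_log hw, Jinv, Jmat]
  ext i j
  fin_cases i <;> fin_cases j <;>
    simp [Matrix.mul_apply, Fin.sum_univ_three] <;> field_simp <;> (try simp only [hs]) <;> ring
end
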